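/- Fix a positive integer n and a positive integer j. The map U restricts to a bijection from the set of compositions (c_1,…,c_t) of n satisfying c_{2i-1} > c_{2i} − 2j for every index i with 2i ≤ t onto the set of compositions of n each of whose parts is either odd or an even number belonging to {2, 4, …, 2j}. -/

import Mathlib

/-- A composition of `n`: a list of positive integers summing to `n`. -/
def IsComposition (n : ℕ) (l : List ℕ) : Prop :=
  (∀ x ∈ l, 0 < x) ∧ l.sum = n

/-- The image of one pair `(x, y)` of parts under the map `U`:
if `x > y` it becomes `(1^{x-y-1}, 2y+1)`; otherwise, with the unique `k ≥ 1`
such that `2k-2 ≤ y-x < 2k` (namely `k = (y-x)/2 + 1`), it becomes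
`(1^{x+y-2k}, 2k)`. -/
def Ustep (x y : ℕ) : List ℕ :=
  if y < x then List.replicate (x - y - 1) 1 ++ [2 * y + 1]
  else List.replicate (x + y - 2 * ((y - x) / 2 + 1)) 1 ++ [2 * ((y - x) / 2 + 1)]

/-- The map `U`: pair up consecutive parts (appending a final `0` when the
length is odd), apply `Ustep` to each pair, and concatenate. -/
def U : List ℕ → List ℕ
  | [] => []
  | [x] => Ustep x 0
  | x :: y :: rest => Ustep x y ++ U rest

/-- The pair `(x, y)` with `Ustep x y = (1^m, b)`, for `2 ≤ b`. -/
def unpair (m b : ℕ) : ℕ × ℕ :=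
  if b % 2 = 1 then (m + b / 2 + 1, b / 2)
  else ((m + 2 - m % 2) / 2, (m + 2 - m % 2) / 2 + (b - 2 + m % 2))

/-- The inverse of `U`, where the first argument counts the ones read so far in the current
block. -/
def invU : ℕ → List ℕ → List ℕ
  | m, [] => if m = 0 then [] else [m]
  | m, b :: l =>
    if b = 1 then invU (m + 1) l else (unpair m b).1 :: (unpair m b).2 :: invU 0 l

theorem Ustep_unpair (m b : ℕ) (hb : 2 ≤ b) :
    Ustep (unpair m b).1 (unpair m b).2 = List.replicate m 1 ++ [b] := by
  unfold Ustep unpair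
  split_ifs <;> dsimp only at * <;> first | omega | (congr 2 <;> omega)

theorem unpair_pos (m b : ℕ) (hb : 2 ≤ b) : 0 < (unpair m b).1 ∧ 0 < (unpair m b).2 := by
  unfold unpair
  split_ifs <;> dsimp only <;> omega

theorem Ustep_zero (x : ℕ) (hx : 0 < x) : Ustep x 0 = List.replicate x 1 := by
  obtain ⟨x, rfl⟩ := Nat.exists_eq_add_of_lt hx
  simp [Ustep, List.replicate_succ']

theorem U_invU (l : List ℕ) (hl : ∀ x ∈ l, 0 < x) (m : ℕ) :
    U (invU m l) = List.replicate m 1 ++ l := by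
  induction l generalizing m with
  | nil =>
    rcases Nat.eq_zero_or_pos m with rfl | hm
    · simp [invU, U]
    · simp [invU, hm.ne', U, Ustep_zero m hm]
  | cons b l ih =>
    have hb : 0 < b := hl b (by simp)
    have hl' : ∀ x ∈ l, 0 < x := fun x hx => hl x (by simp [hx])
    by_cases h : b = 1
    · simp [invU, h, ih hl', List.replicate_succ']
    · simp [invU, h, U, ih hl', Ustep_unpair m b (by omega)]

theorem invU_pos (l : List ℕ) (hl : ∀ x ∈ l, 0 < x) (m : ℕ) : ∀ x ∈ invU m l, 0 < x := by
  induction l generalizing m with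
  | nil =>
    rcases Nat.eq_zero_or_pos m with rfl | hm
    · simp [invU]
    · simp [invU, hm.ne', hm]
  | cons b l ih =>
    have hb : 0 < b := hl b (by simp)
    have hl' : ∀ x ∈ l, 0 < x := fun x hx => hl x (by simp [hx])
    by_cases h : b = 1
    · simpa [invU, h] using ih hl' (m + 1)
    · have hp := unpair_pos m b (by omega)
      simpa [invU, h, hp.1, hp.2] using ih hl' 0

theorem invU_replicate_append (k m : ℕ) (l : List ℕ) :
    invU m (List.replicate k 1 ++ l) = invU (m + k) l := by
  induction k generalizing m with
  | zero => simp
  | succ k ih => simp [List.replicate_succ, invU, ih, Nat.add_comm, Nat.add_left_comm]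

theorem invU_Ustep_append (x y : ℕ) (hx : 0 < x) (hy : 0 < y) (l : List ℕ) :
    invU 0 (Ustep x y ++ l) = x :: y :: invU 0 l := by
  unfold Ustep
  split_ifs with h
  · have h1 : unpair (x - y - 1) (2 * y + 1) = (x, y) := by
      rw [unpair, if_pos (by omega)]
      ext <;> dsimp only <;> omega
    simp [invU_replicate_append, invU, h1, hy.ne']
  · have h1 : unpair (x + y - 2 * ((y - x) / 2 + 1)) (2 * ((y - x) / 2 + 1)) = (x, y) := by
      rw [unpair, if_neg (by omega)]
      ext <;> dsimp only <;> omega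
    have h2 : 2 * ((y - x) / 2 + 1) ≠ 1 := by omega
    rw [List.append_assoc, invU_replicate_append, Nat.zero_add, List.singleton_append, invU,
      if_neg h2, h1]

theorem invU_U (l : List ℕ) (hl : ∀ x ∈ l, 0 < x) : invU 0 (U l) = l := by
  induction l using U.induct with
  | case1 => simp [U, invU]
  | case2 x =>
    have hx : 0 < x := hl x (by simp)
    have h := invU_replicate_append x 0 []
    simp only [List.append_nil] at h
    simp [U, Ustep_zero x hx, h, invU, hx.ne']
  | case3 x y l ih =>
    rw [U, invU_Ustep_append x y (hl x (by simp)) (hl y (by simp)),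
      ih fun z hz => hl z (by simp [hz])]

theorem sum_Ustep (x y : ℕ) (hx : 0 < x) : (Ustep x y).sum = x + y := by
  unfold Ustep
  split_ifs <;> simp <;> omega

theorem sum_U (l : List ℕ) (hl : ∀ x ∈ l, 0 < x) : (U l).sum = l.sum := by
  induction l using U.induct with
  | case1 => simp [U]
  | case2 x => simp [U, sum_Ustep x 0 (hl x (by simp))]
  | case3 x y l ih =>
    simp [U, sum_Ustep x y (hl x (by simp)), ih fun z hz => hl z (by simp [hz]), Nat.add_assoc]

theorem Ustep_pos (x y : ℕ) : ∀ z ∈ Ustep x y, 0 < z := by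
  unfold Ustep
  split_ifs <;> simp only [List.mem_append, List.mem_replicate, List.mem_singleton] <;> omega

theorem U_pos (l : List ℕ) : ∀ z ∈ U l, 0 < z := by
  induction l using U.induct with
  | case1 => simp [U]
  | case2 x => exact Ustep_pos x 0
  | case3 x y l ih =>
    intro z hz
    rw [U, List.mem_append] at hz
    exact hz.elim (Ustep_pos x y z) (ih z)

theorem forall_mem_Ustep_iff (j x y : ℕ) (hj : 0 < j) :
    (∀ z ∈ Ustep x y, Odd z ∨ (Even z ∧ z ≤ 2 * j)) ↔ y < x + 2 * j := by
  simp only [Nat.odd_iff, Nat.even_iff]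
  unfold Ustep
  split_ifs with h
  · simp only [List.mem_append, List.mem_replicate, List.mem_singleton]
    exact ⟨fun _ => by omega, fun _ z hz => by omega⟩
  · simp only [List.mem_append, List.mem_replicate, List.mem_singleton]
    refine ⟨fun H => ?_, fun _ z hz => by omega⟩
    have := H _ (Or.inr rfl)
    omega

theorem forall_mem_U_iff (j : ℕ) (hj : 0 < j) (l : List ℕ) :
    (∀ z ∈ U l, Odd z ∨ (Even z ∧ z ≤ 2 * j)) ↔
      ∀ i : ℕ, 2 * i + 1 < l.length → l.getD (2 * i + 1) 0 < l.getD (2 * i) 0 + 2 * j := by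
  induction l using U.induct with
  | case1 => simp [U]
  | case2 x =>
    rw [U, forall_mem_Ustep_iff j x 0 hj]
    simp only [List.length_singleton]
    exact ⟨fun _ i hi => by omega, fun _ => by omega⟩
  | case3 x y l ih =>
    rw [U, List.forall_mem_append, forall_mem_Ustep_iff j x y hj, ih]
    constructor
    · rintro ⟨h0, h⟩ (_ | i) hi
      · simpa using h0
      · have := h i (by simp only [List.length_cons] at hi; omega)
        simpa [Nat.mul_add] using this
    · intro h
      refine ⟨by simpa using h 0 (by simp), fun i hi => ?_⟩
      have := h (i + 1) (by simp only [List.length_cons]; omega)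
      simpa [Nat.mul_add] using this

/-- `U` restricts to a bijection from the compositions of `n` with
`c_{2i-1} > c_{2i} - 2j` for each pair onto the compositions of `n` whose
parts are all odd or even numbers in `{2, 4, …, 2j}`. -/
theorem U_bijOn_restricted (n j : ℕ) (hn : 0 < n) (hj : 0 < j) :
    Set.BijOn U
      {l : List ℕ | IsComposition n l ∧
        ∀ i : ℕ, 2 * i + 1 < l.length →
          l.getD (2 * i + 1) 0 < l.getD (2 * i) 0 + 2 * j}
      {l : List ℕ | IsComposition n l ∧
        ∀ x ∈ l, Odd x ∨ (Even x ∧ x ≤ 2 * j)} := by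
  refine ⟨?_, ?_, ?_⟩
  · rintro l ⟨⟨hpos, hsum⟩, h⟩
    exact ⟨⟨U_pos l, (sum_U l hpos).trans hsum⟩, (forall_mem_U_iff j hj l).2 h⟩
  · rintro l ⟨⟨hl, -⟩, -⟩ l' ⟨⟨hl', -⟩, -⟩ h
    rw [← invU_U l hl, h, invU_U l' hl']
  · rintro l ⟨⟨hpos, hsum⟩, h⟩
    have hU : U (invU 0 l) = l := by simpa using U_invU l hpos 0
    have hV := invU_pos l hpos 0
    refine ⟨invU 0 l, ⟨⟨hV, ?_⟩, (forall_mem_U_iff j hj _).1 (hU.symm ▸ h)⟩, hU⟩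
    rw [← sum_U _ hV, hU, hsum]
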